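/- Let n be a positive integer, let X₁, …, Xₙ be sets each having at least 3 elements, and let Z be a commutative group written multiplicatively. Let f : X₁ × ⋯ × Xₙ → Z, and suppose that for every index k and every pair of tuples x = (x₁,…,xₙ), x' = (x'₁,…,x'ₙ) satisfying xⱼ ≠ x'ⱼ for every j, the swap condition at index k holds for the pair x, x'. Then for every index k the swap condition holds for all pairs of tuples x, x' (without any restriction); in particular f factorizes through the coordinates. -/

import Mathlib

/-- If the swap condition holds at every index for all pairs of tuples, then the values of `f` on
tuples agreeing with `c` off `s` are determined by its values on one-coordinate changes of `c`. -/
theorem apply_piecewise_eq_mul_prod_of_swap {ι : Type*} [DecidableEq ι] {X : ι → Type*}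
    {Z : Type*} [CommGroup Z] (f : (∀ i, X i) → Z)
    (h : ∀ (k : ι) (x x' : ∀ i, X i),
      f x * f x' = f (Function.update x k (x' k)) * f (Function.update x' k (x k)))
    (c x : ∀ i, X i) (s : Finset ι) :
    f (s.piecewise x c) = f c * ∏ i ∈ s, f (Function.update c i (x i)) / f c := by
  induction s using Finset.induction_on with
  | empty => simp
  | insert k s hk ih =>
    have hs := h k ((insert k s).piecewise x c) c
    have hu : Function.update ((insert k s).piecewise x c) k (c k) = s.piecewise x c := by
      rw [Finset.piecewise_insert, Function.update_idem]
      exact Function.update_eq_self_iff.2 (by simp [hk])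
    rw [hu, ih, Finset.piecewise_insert_self] at hs
    rw [Finset.prod_insert hk, eq_div_of_mul_eq' hs, mul_left_comm, mul_comm, div_eq_mul_inv,
      div_eq_mul_inv]
    ac_rfl

/-- If every coordinate set has at least three elements, the swap condition at `k` for pairs of
tuples that differ in every coordinate implies it for all pairs of tuples. -/
theorem swap_of_distinct_swap {ι : Type*} [DecidableEq ι] {X : ι → Type*}
    {Z : Type*} [CommGroup Z] (h3 : ∀ i : ι, ∃ a b c : X i, a ≠ b ∧ a ≠ c ∧ b ≠ c)
    (f : (∀ i, X i) → Z) (k : ι)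
    (h : ∀ x x' : ∀ i, X i, (∀ j, x j ≠ x' j) →
      f x * f x' = f (Function.update x k (x' k)) * f (Function.update x' k (x k)))
    (x x' : ∀ i, X i) :
    f x * f x' = f (Function.update x k (x' k)) * f (Function.update x' k (x k)) := by
  by_cases hk : x k = x' k
  · rw [← hk, Function.update_eq_self, hk, Function.update_eq_self]
  have hw : ∀ j, ∃ w : X j, x j ≠ w ∧ w ≠ x' j := by
    intro j
    obtain ⟨a, b, c, hab, hac, hbc⟩ := h3 j
    by_contra! hw
    have hw' : ∀ w, w = x j ∨ w = x' j := fun w => or_iff_not_imp_left.2 fun h => hw w (Ne.symm h)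
    have ha := hw' a
    have hb := hw' b
    have hc := hw' c
    grind
  choose w hxw hwx' using hw
  have h₁ := h x (Function.update w k (x' k)) fun j => by
    rcases eq_or_ne j k with rfl | hj
    · simpa using hk
    · simpa [hj] using hxw j
  have h₂ := h (Function.update w k (x k)) x' fun j => by
    rcases eq_or_ne j k with rfl | hj
    · simpa using hk
    · simpa [hj] using hwx' j
  simp only [Function.update_self, Function.update_idem] at h₁ h₂
  rw [← mul_left_inj (f (Function.update w k (x' k))), mul_right_comm, h₁, mul_assoc, h₂]
  ac_rfl

/-- Suppose each `X i` has at least three elements. If the swap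
condition at every index `k` holds for all pairs of tuples `x, x'` whose coordinates
differ everywhere (`x j ≠ x' j` for all `j`), then the swap condition holds for all
pairs of tuples without restriction; in particular `f` factorizes through the
coordinates. -/
theorem factorization_from_distinct_swaps {n : ℕ} (hn : 0 < n) {X : Fin n → Type*}
    {Z : Type*} [CommGroup Z]
    (h3 : ∀ i : Fin n, ∃ a b c : X i, a ≠ b ∧ a ≠ c ∧ b ≠ c)
    (f : (∀ i, X i) → Z)
    (hswap : ∀ (k : Fin n) (x x' : ∀ i, X i), (∀ j : Fin n, x j ≠ x' j) →
      f x * f x' =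
        f (Function.update x k (x' k)) * f (Function.update x' k (x k))) :
    (∀ (k : Fin n) (x x' : ∀ i, X i),
      f x * f x' =
        f (Function.update x k (x' k)) * f (Function.update x' k (x k))) ∧
    (∃ F : ∀ i, X i → Z, ∀ x : ∀ i, X i, f x = ∏ i, F i (x i)) := by
  have h := fun k => swap_of_distinct_swap h3 f k (hswap k)
  refine ⟨h, ?_⟩
  choose c _ using h3
  refine ⟨fun i t => (if i = ⟨0, hn⟩ then f c else 1) * (f (Function.update c i t) / f c),
    fun x => ?_⟩
  have hx := apply_piecewise_eq_mul_prod_of_swap f h c x Finset.univ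
  rw [Finset.piecewise_univ] at hx
  rw [hx, Finset.prod_mul_distrib, Finset.prod_ite_eq', if_pos (Finset.mem_univ _)]
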